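/- (First part of Proposition 2: a priori bound for the stationary HJB equation.) Let δ > 0, let l be a Borel probability measure on Ω, and let U : Ω → ℝ satisfy 0 ≤ U(x) ≤ Ū for all x ∈ Ω. If Φ : Ω → ℝ is continuous and satisfies Φ(x) = U(x) + (1/(2δ)) ∫_Ω ((Φ(z) − Φ(x))₊)² l(dz) for every x ∈ Ω, then 0 ≤ Φ(x) ≤ Ū for all x ∈ Ω. -/

import Mathlib

open MeasureTheory

/-- The action space `Ω = [0,1] ⊆ ℝ` with its Borel σ-algebra. -/
abbrev Ω : Type := Set.Icc (0:ℝ) 1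

/-- **A priori bound for the stationary HJB equation** (first part of Proposition 2).
If `Φ` is a continuous solution of
`Φ(x) = U(x) + (1/(2δ)) ∫ ((Φ(z) − Φ(x))₊)² l(dz)`, with `0 ≤ U ≤ Ū`,
then `0 ≤ Φ ≤ Ū`. -/
theorem stmt0
    (Ubar : ℝ) (hUbar : 0 < Ubar)
    (δ : ℝ) (hδ : 0 < δ)
    (l : Measure Ω) [IsProbabilityMeasure l]
    (U : Ω → ℝ) (hU : ∀ x, 0 ≤ U x ∧ U x ≤ Ubar)
    (Φ : Ω → ℝ) (hΦc : Continuous Φ)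
    (hfix : ∀ x, Φ x = U x + (1 / (2 * δ)) * ∫ z, (max (Φ z - Φ x) 0) ^ 2 ∂l) :
    ∀ x, 0 ≤ Φ x ∧ Φ x ≤ Ubar := by
  obtain ⟨x0, -, hx0⟩ := isCompact_univ.exists_isMaxOn
    (⟨⟨0, by simp⟩, Set.mem_univ _⟩ : (Set.univ : Set Ω).Nonempty) hΦc.continuousOn
  have hle : ∀ z, Φ z ≤ Φ x0 := fun z => hx0 (Set.mem_univ z)
  have hmax : Φ x0 = U x0 := by
    have h := hfix x0
    have hz : ∀ z, (max (Φ z - Φ x0) 0) ^ 2 = 0 := fun z => by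
      rw [max_eq_right (by linarith [hle z])]; norm_num
    simp only [hz, integral_zero, mul_zero, add_zero] at h
    exact h
  intro x
  refine ⟨?_, ?_⟩
  · rw [hfix x]
    have hI : 0 ≤ ∫ z, (max (Φ z - Φ x) 0) ^ 2 ∂l := integral_nonneg fun z => sq_nonneg _
    have := (hU x).1
    positivity
  · linarith [hle x, (hU x0).2]
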